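/- There do not exist a Borel map ψ : ℕ^ℕ → [ω]^ω and a CONTINUOUS map φ : [ω]^ω → ℕ^ℕ satisfying: (a) the family ψ(ℕ^ℕ) is centered, and (b) for every A ∈ [ω]^ω and every f ∈ ℕ^ℕ, if A ⊆* ψ(f) then f ≤* φ(A). (Thus in the Borel morphism witnessing 𝔟 ≥_BT 𝔭, the map φ cannot be improved to a continuous one.) -/

import Mathlib

open Filter

/-- The subset of ℕ coded by an element of Cantor space. -/
def bset (x : ℕ → Bool) : Set ℕ := {n | x n = true}

/-- `[ω]^ω`, regarded as a subspace of Cantor space via characteristic functions. -/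
abbrev InfC := {x : ℕ → Bool // (bset x).Infinite}

/-- `A ⊆* B`: `A ∖ B` is finite. -/
def SubStar (A B : Set ℕ) : Prop := (A \ B).Finite

/-- A family of infinite sets is centered iff every nonempty finite subfamily
has infinite intersection. -/
def Centered (F : Set InfC) : Prop :=
  ∀ s : Finset InfC, ↑s ⊆ F → s.Nonempty → (⋂ x ∈ s, bset x.1).Infinite


/-- Finite modification of `x` by the finite set `s`. -/
noncomputable def modi (s : Finset ℕ) (x : ℕ → Bool) : ℕ → Bool :=
  fun i => if i ∈ s then !(x i) else x i

/-- Flip everything from `n` on. -/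
def flipFrom (n : ℕ) (x : ℕ → Bool) : ℕ → Bool :=
  fun i => if i < n then x i else !(x i)

lemma modi_modi (s : Finset ℕ) (x : ℕ → Bool) : modi s (modi s x) = x := by
  funext i; unfold modi; split_ifs <;> simp

lemma flipFrom_flipFrom (s : ℕ) (x : ℕ → Bool) : flipFrom s (flipFrom s x) = x := by
  funext i; unfold flipFrom; split_ifs <;> simp

lemma cont_modi (s : Finset ℕ) : Continuous (modi s) := by
  refine continuous_pi fun i => ?_
  unfold modi
  split_ifs
  · exact (continuous_of_discreteTopology (f := Bool.not)).comp (continuous_apply i)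
  · exact continuous_apply i

lemma cont_flip (s : ℕ) : Continuous (flipFrom s) := by
  refine continuous_pi fun i => ?_
  unfold flipFrom
  split_ifs
  · exact continuous_apply i
  · exact (continuous_of_discreteTopology (f := Bool.not)).comp (continuous_apply i)

lemma residual_preimage {f : (ℕ → Bool) → (ℕ → Bool)} (hf : Continuous f)
    (hff : ∀ x, f (f x) = x) {S : Set (ℕ → Bool)} (hS : S ∈ residual (ℕ → Bool)) :
    f ⁻¹' S ∈ residual (ℕ → Bool) := by
  let e : (ℕ → Bool) ≃ₜ (ℕ → Bool) := ⟨⟨f, f, hff, hff⟩, hf, hf⟩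
  exact tendsto_residual_of_isOpenMap e.continuous e.isOpenMap hS

lemma exists_cyl (x : ℕ → Bool) {U : Set (ℕ → Bool)} (hU : U ∈ nhds x) (m : ℕ) :
    ∃ m', m < m' ∧ ∀ y : ℕ → Bool, (∀ i < m', y i = x i) → y ∈ U := by
  rw [nhds_pi, Filter.mem_pi] at hU
  obtain ⟨I, hI, t, ht, hsub⟩ := hU
  obtain ⟨b, hb⟩ := hI.bddAbove
  refine ⟨max b m + 1, by omega, fun y hy => hsub fun i hi => ?_⟩
  rw [hy i (by have := hb hi; omega)]
  exact mem_of_mem_nhds (ht i)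

lemma isOpen_cyl (x : ℕ → Bool) (m : ℕ) : IsOpen {y : ℕ → Bool | ∀ i < m, y i = x i} := by
  have : {y : ℕ → Bool | ∀ i < m, y i = x i} = ⋂ i ∈ Finset.range m, {y | y i = x i} := by
    ext y; simp
  rw [this]
  refine isOpen_biInter_finset fun i _ => ?_
  have hc : Continuous (fun y : ℕ → Bool => y i) := continuous_apply i
  exact (isOpen_discrete ({x i} : Set Bool)).preimage hc

/-- A Borel set disjoint from all its tail-flips is meager. -/
lemma meager_of_flip {B : Set (ℕ → Bool)} (hB : MeasurableSet B)
    (h : ∀ n, ∀ x ∈ B, flipFrom n x ∉ B) : Bᶜ ∈ residual (ℕ → Bool) := by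
  obtain ⟨U, hU, hBU⟩ := hB.residualEq_isOpen
  have hE : {x | x ∈ B ↔ x ∈ U} ∈ residual (ℕ → Bool) := by
    filter_upwards [hBU] with x hx
    exact iff_of_eq hx
  by_cases hne : U.Nonempty
  · exfalso
    obtain ⟨x, hx⟩ := hne
    obtain ⟨m, -, hm⟩ := exists_cyl x (hU.mem_nhds hx) 0
    have hd := dense_of_mem_residual
      (Filter.inter_mem hE (residual_preimage (cont_flip m) (flipFrom_flipFrom m) hE))
    obtain ⟨y, hy, hy1, hy2⟩ := hd.inter_open_nonempty _ (isOpen_cyl x m) ⟨x, fun i _ => rfl⟩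
    have h1 : y ∈ B := hy1.2 (hm y hy)
    have h2 : flipFrom m y ∈ B := hy2.2 (hm _ fun i hi => by
      simp only [flipFrom, hi, if_true]; exact hy i hi)
    exact h m y h1 h2
  · rw [Set.not_nonempty_iff_eq_empty] at hne
    filter_upwards [hE] with x hx
    simp only [hne, Set.mem_empty_iff_false, iff_false] at hx
    exact hx

/-- Talagrand / Jalali-Naini. -/
lemma talagrand {F : Set (ℕ → Bool)} (hF : Fᶜ ∈ residual (ℕ → Bool))
    (hup : ∀ x ∈ F, ∀ y : ℕ → Bool, (∀ i, x i = true → y i = true) → y ∈ F) :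
    ∃ m : ℕ → ℕ, StrictMono m ∧ ∀ y ∈ F, ∃ N, ∀ n ≥ N, ∃ i, m n ≤ i ∧ i < m (n+1) ∧ y i = true := by
  obtain ⟨G, hGF, hG, hGd⟩ := mem_residual.1 hF
  obtain ⟨D, hD, rfl⟩ := isGδ_iff_eq_iInter_nat.1 hG
  have hGr : (⋂ n, D n) ∈ residual (ℕ → Bool) := residual_of_dense_Gδ hG hGd
  have hall : (⋂ s : Finset ℕ, modi s ⁻¹' (⋂ n, D n)) ∈ residual (ℕ → Bool) :=
    countable_iInter_mem.2 fun s => residual_preimage (cont_modi s) (modi_modi s) hGr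
  obtain ⟨x, hx⟩ := (dense_of_mem_residual hall).nonempty
  simp only [Set.mem_iInter, Set.mem_preimage] at hx
  have step : ∀ n m : ℕ, ∃ m', m < m' ∧ ∀ y : ℕ → Bool,
      (∀ i, m ≤ i → i < m' → y i = x i) → ∀ j ≤ n, y ∈ D j := by
    intro n m
    have hnh : (⋂ j ∈ Finset.range (n+1), ⋂ s ∈ (Finset.range m).powerset, modi s ⁻¹' (D j))
        ∈ nhds x := by
      refine (Filter.biInter_finset_mem _).2 fun j _ =>
        (Filter.biInter_finset_mem _).2 fun s _ => ?_
      exact ((hD j).preimage (cont_modi s)).mem_nhds (hx s j)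
    obtain ⟨m', hmm, hm'⟩ := exists_cyl x hnh m
    refine ⟨m', hmm, fun y hy j hj => ?_⟩
    let s := (Finset.range m).filter fun i => y i ≠ x i
    have := hm' (modi s y) (fun i hi => by
      by_cases him : i < m
      · by_cases hyx : y i = x i
        · simp [modi, s, hyx]
        · simp only [modi, s, Finset.mem_filter, Finset.mem_range, him, ne_eq, hyx,
            not_false_eq_true, and_self, if_true]
          revert hyx; cases y i <;> cases x i <;> simp
      · simp only [modi, s, Finset.mem_filter, Finset.mem_range, him, false_and, if_false]
        exact hy i (by omega) hi)
    simp only [Set.mem_iInter, Set.mem_preimage] at this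
    have h2 := this j (by simp; omega) s (by simp [s])
    rwa [modi_modi] at h2
  choose M hM1 hM2 using step
  let m : ℕ → ℕ := fun n => Nat.rec 0 (fun k r => M k r) n
  have hms : ∀ n, m (n+1) = M n (m n) := fun n => rfl
  refine ⟨m, strictMono_nat_of_lt_succ fun n => by rw [hms]; exact hM1 _ _, fun y hy => ?_⟩
  by_contra hcon
  push Not at hcon
  have hz : (fun i => y i || x i) ∈ F := hup y hy _ fun i hi => by simp [hi]
  refine hGF (Set.mem_iInter.2 fun j => ?_) hz
  obtain ⟨n, hn, hno⟩ := hcon j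
  refine hM2 n (m n) _ (fun i h1 h2 => ?_) j hn
  have := hno i h1 (by rw [hms]; exact h2)
  simp only [Bool.not_eq_true] at this
  simp [this]

/-- The filter generated by the range. -/
def genF (ψ : (ℕ → ℕ) → InfC) : Set (ℕ → Bool) :=
  {x | ∃ k : ℕ, ∃ f : ℕ → (ℕ → ℕ), ∀ i, (∀ j ≤ k, (ψ (f j)).1 i = true) → x i = true}

lemma genF_analytic (ψ : (ℕ → ℕ) → InfC) (hψ : Measurable ψ) :
    MeasureTheory.AnalyticSet (genF ψ) := by
  classical
  let Φ : ℕ → (ℕ → (ℕ → ℕ)) × (ℕ → Bool) → (ℕ → Bool) := fun k p i =>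
    p.2 i || decide (∀ j ≤ k, (ψ (p.1 j)).1 i = true)
  have hm : ∀ k, Measurable (Φ k) := by
    intro k
    refine measurable_pi_lambda _ fun i => measurable_to_bool ?_
    have : (fun p => Φ k p i) ⁻¹' {true} =
        {p | p.2 i = true} ∪ ⋂ j ∈ Finset.range (k+1), {p | (ψ (p.1 j)).1 i = true} := by
      ext p; simp [Φ]
    rw [this]
    refine MeasurableSet.union ?_ (Finset.measurableSet_biInter _ fun j _ => ?_)
    · have h0 : Measurable (fun p : (ℕ → (ℕ → ℕ)) × (ℕ → Bool) => p.2 i) :=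
        (measurable_pi_apply i).comp measurable_snd
      exact h0 (measurableSet_singleton true)
    · have h0 : Measurable (fun p : (ℕ → (ℕ → ℕ)) × (ℕ → Bool) => (ψ (p.1 j)).1 i) :=
        (measurable_pi_apply i).comp (measurable_subtype_coe.comp
          (hψ.comp ((measurable_pi_apply j).comp measurable_fst)))
      exact h0 (measurableSet_singleton true)
  have hE : genF ψ = ⋃ k, Φ k '' Set.univ := by
    ext x
    simp only [genF, Set.mem_ofPred_eq, Set.mem_iUnion, Set.image_univ, Set.mem_range, Prod.exists]
    constructor
    · rintro ⟨k, f, h⟩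
      refine ⟨k, f, x, ?_⟩
      funext i
      by_cases hh : ∀ j ≤ k, (ψ (f j)).1 i = true
      · simp [Φ, h i hh]
      · simp only [Φ, hh, decide_false, Bool.or_false]
    · rintro ⟨k, f, y, rfl⟩
      refine ⟨k, f, fun i hi => ?_⟩
      simp only [Φ, Bool.or_eq_true, decide_eq_true_eq]
      exact Or.inr hi
  rw [hE]
  exact MeasureTheory.AnalyticSet.iUnion fun k =>
    MeasurableSet.univ.analyticSet_image (hm k)

lemma genF_flip (ψ : (ℕ → ℕ) → InfC) (hc : Centered (Set.range ψ)) (n : ℕ) (x : ℕ → Bool)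
    (hx : x ∈ genF ψ) : flipFrom n x ∉ genF ψ := by
  classical
  rintro ⟨k', f', h'⟩
  obtain ⟨k, f, h⟩ := hx
  let s : Finset InfC := (Finset.range (k+1)).image (fun j => ψ (f j)) ∪
    (Finset.range (k'+1)).image (fun j => ψ (f' j))
  have hinf := hc s (by
    intro z hz
    simp only [s, Finset.coe_union, Finset.coe_image, Set.mem_union, Set.mem_image] at hz
    rcases hz with ⟨j, -, rfl⟩ | ⟨j, -, rfl⟩ <;> exact ⟨_, rfl⟩)
    ⟨ψ (f 0), by simp only [s, Finset.mem_union, Finset.mem_image]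
                 exact Or.inl ⟨0, by simp, rfl⟩⟩
  obtain ⟨i, hi, hni⟩ := hinf.exists_gt n
  simp only [Set.mem_iInter] at hi
  have h1 := h i fun j hj => hi _ (by
    simp only [s, Finset.mem_union, Finset.mem_image]
    exact Or.inl ⟨j, by simp; omega, rfl⟩)
  have h2 := h' i fun j hj => hi _ (by
    simp only [s, Finset.mem_union, Finset.mem_image]
    exact Or.inr ⟨j, by simp; omega, rfl⟩)
  simp [flipFrom, h1, hni.le.not_gt] at h2

lemma genF_meager (ψ : (ℕ → ℕ) → InfC) (hψ : Measurable ψ) (hc : Centered (Set.range ψ)) :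
    (genF ψ)ᶜ ∈ residual (ℕ → Bool) := by
  have hF := genF_analytic ψ hψ
  have hI : MeasureTheory.AnalyticSet (⋃ n, flipFrom n '' genF ψ) :=
    MeasureTheory.AnalyticSet.iUnion fun n => hF.image_of_continuous (cont_flip n)
  have hdis : Disjoint (genF ψ) (⋃ n, flipFrom n '' genF ψ) := by
    rw [Set.disjoint_left]
    intro x hx hx2
    obtain ⟨n, z, hz, rfl⟩ := Set.mem_iUnion.1 hx2
    exact genF_flip ψ hc n z hz hx
  obtain ⟨B, hFB, hIB, hB⟩ := hF.measurablySeparable hI hdis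
  let B' : Set (ℕ → Bool) := B ∩ ⋂ n, flipFrom n ⁻¹' Bᶜ
  have hB' : MeasurableSet B' :=
    hB.inter (MeasurableSet.iInter fun n => (cont_flip n).measurable hB.compl)
  have hres := meager_of_flip hB' (fun n x hx hx2 => by
    exact (Set.mem_iInter.1 hx.2 n) hx2.1)
  refine Filter.mem_of_superset hres (Set.compl_subset_compl.2 fun x hx => ⟨hFB hx, ?_⟩)
  refine Set.mem_iInter.2 fun n => ?_
  exact fun hb => Set.disjoint_left.1 hIB (Set.mem_iUnion.2 ⟨n, x, hx, rfl⟩) hb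

lemma compact_K (m : ℕ → ℕ) (hm : StrictMono m) (N : ℕ) :
    IsCompact {x : InfC | ∀ n ≥ N, ∃ i, m n ≤ i ∧ i < m (n+1) ∧ x.1 i = true} := by
  rw [Subtype.isCompact_iff]
  have : ((↑) '' {x : InfC | ∀ n ≥ N, ∃ i, m n ≤ i ∧ i < m (n+1) ∧ x.1 i = true} :
      Set (ℕ → Bool)) = ⋂ n ∈ Set.Ici N, ⋃ i ∈ Finset.Ico (m n) (m (n+1)), {x | x i = true} := by
    ext x
    simp only [Set.mem_image, Set.mem_ofPred_eq, Set.mem_iInter, Set.mem_iUnion, Set.mem_Ici,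
      Finset.mem_Ico]
    constructor
    · rintro ⟨y, hy, rfl⟩ n hn
      obtain ⟨i, h1, h2, h3⟩ := hy n hn
      exact ⟨i, ⟨h1, h2⟩, h3⟩
    · intro h
      refine ⟨⟨x, ?_⟩, fun n hn => ?_, rfl⟩
      · refine Set.infinite_of_not_bddAbove ?_
        rintro ⟨b, hb⟩
        obtain ⟨i, ⟨h1, h2⟩, h3⟩ := h (max N (b+1)) (le_max_left _ _)
        have h4 := hb (show i ∈ bset x from h3)
        have h5 := hm.le_apply (x := max N (b+1))
        omega
      · obtain ⟨i, ⟨h1, h2⟩, h3⟩ := h n hn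
        exact ⟨i, h1, h2, h3⟩
  rw [this]
  refine IsClosed.isCompact (isClosed_biInter fun n _ => isClosed_biUnion_finset fun i _ => ?_)
  have hc : Continuous (fun y : ℕ → Bool => y i) := continuous_apply i
  exact (isClosed_discrete ({true} : Set Bool)).preimage hc

/-- There are no Borel `ψ : ℕ^ℕ → [ω]^ω` and CONTINUOUS `φ : [ω]^ω → ℕ^ℕ`
with (a) `ψ(ℕ^ℕ)` centered and (b) `A ⊆* ψ(f)` implies `f ≤* φ(A)`.
(The map `φ` in the morphism witnessing 𝔟 ≥_BT 𝔭 cannot be continuous.) -/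
theorem stmt9 :
    ¬ ∃ (ψ : (ℕ → ℕ) → InfC) (φ : InfC → (ℕ → ℕ)),
      Measurable ψ ∧ Continuous φ ∧
      Centered (Set.range ψ) ∧
      ∀ (A : InfC) (f : ℕ → ℕ), SubStar (bset A.1) (bset (ψ f).1) →
        ∀ᶠ n in cofinite, f n ≤ φ A n := by
  rintro ⟨ψ, φ, hψ, hφ, hc, hb⟩
  obtain ⟨m, hm, hK⟩ := talagrand (genF_meager ψ hψ hc)
    (fun x ⟨k, f, h⟩ y hy => ⟨k, f, fun i hi => hy i (h i hi)⟩)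
  have hbd : ∀ N k, ∃ b, ∀ x : InfC,
      (∀ n ≥ N, ∃ i, m n ≤ i ∧ i < m (n+1) ∧ x.1 i = true) → φ x k ≤ b := by
    intro N k
    obtain ⟨b, hb⟩ := ((compact_K m hm N).image
      ((continuous_apply k).comp hφ)).bddAbove
    exact ⟨b, fun x hx => hb ⟨x, hx, rfl⟩⟩
  choose g hg using hbd
  let f : ℕ → ℕ := fun k => (Finset.range (k+1)).sup (fun N => g N k) + 1
  obtain ⟨N, hN⟩ := hK (ψ f).1 ⟨0, fun _ => f, fun i hi => hi 0 le_rfl⟩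
  have hev := hb (ψ f) f (by simp [SubStar])
  rw [Nat.cofinite_eq_atTop] at hev
  obtain ⟨k, hk, hNk⟩ := (hev.and (eventually_ge_atTop N)).exists
  have h1 := hg N k (ψ f) hN
  have h2 : g N k ≤ (Finset.range (k+1)).sup (fun N => g N k) :=
    Finset.le_sup (f := fun N => g N k) (by simp; omega)
  simp only [f] at hk h1
  omega
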